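/- Assume case (BS2) and fix k ≥ 1. For i ∈ [0, c)^{k+1} let α(i) = b^{i_0} a b^{i_1} a ⋯ b^{i_k} a, and let ψ : [0, c)^{k+1} → [0, c)^{k+1} and r : [0, c)^{k+1} → ℤ_{≥1} be the unique maps satisfying b^{d·r(i)} α(ψ(i)) = α(i) b^c. Then for every h ≥ 0 and every integer m with i_0 + d·∑_{μ=0}^{h−1} r(ψ^μ(i)) < m ≤ i_0 + d·∑_{μ=0}^{h} r(ψ^μ(i)), the element α(i) b^{(h+1)c} = b^{d·∑_{μ=0}^{h} r(ψ^μ(i))} α(ψ^{h+1}(i)) is the unique minimal common extension of b^m and α(i); that is, b^m Λ ∩ α(i) Λ = α(i) b^{(h+1)c} Λ. -/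

import Mathlib

inductive BSGen : Type
  | a : BSGen
  | b : BSGen

/-- The relations for the Baumslag–Solitar presentation `⟨a, b | a bᶜ = bᵉ a⟩`.
For cases (BS1), (BS2) take `e = d`; for case (BS3) take `e = -d`. -/
def BSRel (c e : ℤ) : Set (FreeGroup BSGen) :=
  {FreeGroup.of BSGen.a * FreeGroup.of BSGen.b ^ c *
    (FreeGroup.of BSGen.b ^ e * FreeGroup.of BSGen.a)⁻¹}

/-- The Baumslag–Solitar group `Γ = ⟨a, b | a bᶜ = bᵉ a⟩`. -/
abbrev BSGroup (c e : ℤ) := PresentedGroup (BSRel c e)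

/-- The generator `a` of `Γ`. -/
def bsa (c e : ℤ) : BSGroup c e := PresentedGroup.of BSGen.a

/-- The generator `b` of `Γ`. -/
def bsb (c e : ℤ) : BSGroup c e := PresentedGroup.of BSGen.b

/-- `Λ`, the submonoid of `Γ` generated by `a` and `b`. -/
def bsΛ (c e : ℤ) : Submonoid (BSGroup c e) :=
  Submonoid.closure {bsa c e, bsb c e}

/-- For a tuple `i : Fin n → ℤ`, the element `α(i) = b^{i₀} a b^{i₁} a ⋯ b^{i_{n-1}} a`. -/
def alphaTup (c e : ℤ) {n : ℕ} (i : Fin n → ℤ) : BSGroup c e :=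
  (List.ofFn (fun μ : Fin n => bsb c e ^ i μ * bsa c e)).prod

theorem bsa_mul_bsb_zpow (c d q : ℤ) :
    bsa c d * bsb c d ^ (c * q) = bsb c d ^ (d * q) * bsa c d := by
  have hrel : bsa c d * bsb c d ^ c = bsb c d ^ d * bsa c d := by
    have h : PresentedGroup.mk (BSRel c d) (FreeGroup.of BSGen.a * FreeGroup.of BSGen.b ^ c *
        (FreeGroup.of BSGen.b ^ d * FreeGroup.of BSGen.a)⁻¹) = 1 :=
      PresentedGroup.one_of_mem rfl
    rw [map_mul, map_inv, mul_inv_eq_one] at h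
    simp only [map_mul, map_zpow] at h
    exact h
  have hconj : SemiconjBy (bsa c d) (bsb c d ^ c) (bsb c d ^ d) := hrel
  simpa only [zpow_mul] using (hconj.zpow_right q).eq

theorem bsb_zpow_mem (c d : ℤ) {n : ℤ} (hn : 0 ≤ n) : bsb c d ^ n ∈ bsΛ c d := by
  lift n to ℕ using hn
  rw [zpow_natCast]
  exact pow_mem (Submonoid.subset_closure (by simp)) n

theorem bsa_mem (c d : ℤ) : bsa c d ∈ bsΛ c d := Submonoid.subset_closure (by simp)

/-- Elements of `Λ` are nonnegative powers of `b`, or begin with such a power followed by `a`. -/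
theorem bsΛ_cases (c d : ℤ) {x : BSGroup c d} (hx : x ∈ bsΛ c d) :
    (∃ n : ℤ, 0 ≤ n ∧ x = bsb c d ^ n) ∨
      ∃ n : ℤ, 0 ≤ n ∧ ∃ y ∈ bsΛ c d, x = bsb c d ^ n * bsa c d * y := by
  induction hx using Submonoid.closure_induction_left with
  | one => exact .inl ⟨0, le_rfl, by simp⟩
  | mul_left g hg y hy ih =>
    rcases hg with rfl | rfl
    · exact .inr ⟨0, le_rfl, y, hy, by simp⟩
    · rcases ih with ⟨n, hn, rfl⟩ | ⟨n, hn, z, hz, rfl⟩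
      · exact .inl ⟨1 + n, by omega, by rw [zpow_one_add]⟩
      · exact .inr ⟨1 + n, by omega, z, hz, by simp only [zpow_one_add, mul_assoc]⟩

/-- The submonoid of `Γ` generated by `a`, `b` and `b⁻¹`. -/
def bsPos (c e : ℤ) : Submonoid (BSGroup c e) :=
  Submonoid.closure {bsa c e, bsb c e, (bsb c e)⁻¹}

theorem bsΛ_le_bsPos (c d : ℤ) : bsΛ c d ≤ bsPos c d :=
  Submonoid.closure_mono (by grind)

theorem bsb_zpow_mem_bsPos (c d n : ℤ) : bsb c d ^ n ∈ bsPos c d := by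
  obtain ⟨m, rfl | rfl⟩ := n.eq_nat_or_neg
  · exact bsΛ_le_bsPos c d (bsb_zpow_mem c d (by omega))
  · rw [zpow_neg, zpow_natCast, ← inv_pow]
    exact pow_mem (Submonoid.subset_closure (by simp)) m

theorem zpowGroupHom_int_injective {n : ℤ} (hn : n ≠ 0) :
    Function.Injective (zpowGroupHom n : Multiplicative ℤ →* Multiplicative ℤ) := by
  intro x y hxy
  have h : n * x.toAdd = n * y.toAdd := by simpa using congrArg Multiplicative.toAdd hxy
  exact Multiplicative.toAdd.injective (mul_left_cancel₀ hn h)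

/-- The isomorphism from `cℤ` to `dℤ` which sends `c` to `d`. -/
noncomputable def zmultiplesEquiv {c d : ℤ} (hc : c ≠ 0) (hd : d ≠ 0) :
    (zpowGroupHom c : Multiplicative ℤ →* Multiplicative ℤ).range ≃*
      (zpowGroupHom d : Multiplicative ℤ →* Multiplicative ℤ).range :=
  (MonoidHom.ofInjective (zpowGroupHom_int_injective hc)).symm.trans
    (MonoidHom.ofInjective (zpowGroupHom_int_injective hd))

theorem coe_zmultiplesEquiv {c d : ℤ} (hc : c ≠ 0) (hd : d ≠ 0) (x : Multiplicative ℤ) :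
    (zmultiplesEquiv hc hd ⟨x ^ c, x, rfl⟩ : Multiplicative ℤ) = x ^ d := by
  have h : MonoidHom.ofInjective (zpowGroupHom_int_injective hc) x = ⟨x ^ c, x, rfl⟩ := rfl
  rw [← h, zmultiplesEquiv, MulEquiv.trans_apply, MulEquiv.symm_apply_apply]
  rfl

/-- The comparison map from `Γ` to the HNN extension of `ℤ` that conjugates `cℤ` to `dℤ`. -/
noncomputable def bsToHNN {c d : ℤ} (hc : c ≠ 0) (hd : d ≠ 0) :
    BSGroup c d →* HNNExtension (Multiplicative ℤ) _ _ (zmultiplesEquiv hc hd) :=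
  PresentedGroup.toGroup
    (f := fun g => BSGen.casesOn g HNNExtension.t (HNNExtension.of (Multiplicative.ofAdd 1))) <| by
    rintro _ rfl
    have h := HNNExtension.t_mul_of (φ := zmultiplesEquiv hc hd)
      ⟨Multiplicative.ofAdd 1 ^ c, Multiplicative.ofAdd 1, rfl⟩
    rw [coe_zmultiplesEquiv, map_zpow, map_zpow] at h
    simp only [map_mul, map_inv, map_zpow, FreeGroup.lift_apply_of]
    exact mul_inv_eq_one.2 h

theorem bsToHNN_bsa {c d : ℤ} (hc : c ≠ 0) (hd : d ≠ 0) :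
    bsToHNN hc hd (bsa c d) = HNNExtension.t := by
  simp [bsToHNN, bsa]

theorem bsToHNN_bsb_zpow {c d : ℤ} (hc : c ≠ 0) (hd : d ≠ 0) (n : ℤ) :
    bsToHNN hc hd (bsb c d ^ n) = HNNExtension.of (Multiplicative.ofAdd n) := by
  have h : Multiplicative.ofAdd n = Multiplicative.ofAdd (1 : ℤ) ^ n := by
    simp [← ofAdd_zsmul]
  rw [map_zpow, h, map_zpow]
  simp [bsToHNN, bsb]

/-- Elements of `bsPos` are represented by reduced words in which only `t` occurs, not `t⁻¹`. -/
theorem exists_reducedWord_of_mem_bsPos {c d : ℤ} (hc : c ≠ 0) (hd : d ≠ 0) {w : BSGroup c d}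
    (hw : w ∈ bsPos c d) :
    ∃ v : HNNExtension.NormalWord.ReducedWord (Multiplicative ℤ)
        (zpowGroupHom c : Multiplicative ℤ →* Multiplicative ℤ).range
        (zpowGroupHom d : Multiplicative ℤ →* Multiplicative ℤ).range,
      (∀ p ∈ v.toList, p.1 = 1) ∧ v.prod (zmultiplesEquiv hc hd) = bsToHNN hc hd w := by
  induction hw using Submonoid.closure_induction_left with
  | one => exact ⟨.empty _ _ _, by simp, by simp [HNNExtension.NormalWord.ReducedWord.prod]⟩
  | mul_left g hg y hy ih =>
    obtain ⟨v, hv, hprod⟩ := ih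
    have hb : ∀ n : ℤ, ∃ v : HNNExtension.NormalWord.ReducedWord (Multiplicative ℤ)
        (zpowGroupHom c : Multiplicative ℤ →* Multiplicative ℤ).range
        (zpowGroupHom d : Multiplicative ℤ →* Multiplicative ℤ).range,
        (∀ p ∈ v.toList, p.1 = 1) ∧
          v.prod (zmultiplesEquiv hc hd) = bsToHNN hc hd (bsb c d ^ n * y) := fun n =>
      ⟨⟨Multiplicative.ofAdd n * v.head, v.toList, v.chain⟩, hv, by
        rw [map_mul, bsToHNN_bsb_zpow, ← hprod]
        simp only [HNNExtension.NormalWord.ReducedWord.prod, map_mul, mul_assoc]⟩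
    rcases hg with rfl | rfl | rfl
    · refine ⟨⟨1, (1, v.head) :: v.toList, ?_⟩, ?_, ?_⟩
      · exact List.isChain_cons.2 ⟨fun p hp _ => (hv p (List.mem_of_mem_head? hp)).symm, v.chain⟩
      · simpa using hv
      · rw [map_mul, bsToHNN_bsa, ← hprod]
        simp [HNNExtension.NormalWord.ReducedWord.prod, mul_assoc]
    · simpa using hb 1
    · simpa using hb (-1)

theorem exists_reducedWord_bsb_zpow_mul_bsa_mul {c d : ℤ} (hc : c ≠ 0) (hd : d ≠ 0) (s : ℤ)
    {w : BSGroup c d} (hw : w ∈ bsPos c d) :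
    ∃ v : HNNExtension.NormalWord.ReducedWord (Multiplicative ℤ)
        (zpowGroupHom c : Multiplicative ℤ →* Multiplicative ℤ).range
        (zpowGroupHom d : Multiplicative ℤ →* Multiplicative ℤ).range,
      v.head = Multiplicative.ofAdd s ∧ v.toList.head?.map Prod.fst = some 1 ∧
        v.prod (zmultiplesEquiv hc hd) = bsToHNN hc hd (bsb c d ^ s * bsa c d * w) := by
  obtain ⟨v, hv, hprod⟩ := exists_reducedWord_of_mem_bsPos hc hd hw
  refine ⟨⟨Multiplicative.ofAdd s, (1, v.head) :: v.toList, ?_⟩, rfl, rfl, ?_⟩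
  · exact List.isChain_cons.2 ⟨fun p hp _ => (hv p (List.mem_of_mem_head? hp)).symm, v.chain⟩
  · rw [map_mul, map_mul, bsToHNN_bsa, bsToHNN_bsb_zpow, ← hprod]
    simp [HNNExtension.NormalWord.ReducedWord.prod, mul_assoc]

theorem dvd_sub_of_bsb_zpow_mul_bsa_mul_eq {c d : ℤ} (hc : c ≠ 0) (hd : d ≠ 0) {s s' : ℤ}
    {w w' : BSGroup c d} (hw : w ∈ bsPos c d) (hw' : w' ∈ bsPos c d)
    (h : bsb c d ^ s * bsa c d * w = bsb c d ^ s' * bsa c d * w') : d ∣ s' - s := by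
  obtain ⟨v, hvh, hvl, hv⟩ := exists_reducedWord_bsb_zpow_mul_bsa_mul hc hd s hw
  obtain ⟨v', hvh', -, hv'⟩ := exists_reducedWord_bsb_zpow_mul_bsa_mul hc hd s' hw'
  have key := (HNNExtension.ReducedWord.map_fst_eq_and_of_prod_eq _
    (hv.trans ((congrArg _ h).trans hv'.symm))).2 1 hvl
  rw [hvh, hvh', HNNExtension.toSubgroup_neg_one] at key
  obtain ⟨x, hx⟩ := key
  have hx := congrArg Multiplicative.toAdd hx
  simp only [zpowGroupHom_apply, toAdd_zpow, toAdd_mul, toAdd_inv, toAdd_ofAdd, smul_eq_mul] at hx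
  exact ⟨x.toAdd, by omega⟩

theorem bsb_zpow_mul_bsa_mul_ne {c d : ℤ} (hc : c ≠ 0) (hd : d ≠ 0) (s n : ℤ)
    {w : BSGroup c d} (hw : w ∈ bsPos c d) : bsb c d ^ s * bsa c d * w ≠ bsb c d ^ n := by
  intro h
  obtain ⟨v, -, hvl, hv⟩ := exists_reducedWord_bsb_zpow_mul_bsa_mul hc hd s hw
  have hnil := HNNExtension.ReducedWord.toList_eq_nil_of_mem_of_range _ v
    ⟨Multiplicative.ofAdd n, by rw [hv, h, bsToHNN_bsb_zpow]⟩
  simp [hnil] at hvl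

/-- Division by `d` with remainder moves a power of `b` past `a`. -/
theorem bsb_zpow_mul_bsa_eq (c d e : ℤ) :
    bsb c d ^ e * bsa c d = bsb c d ^ (e % d) * bsa c d * bsb c d ^ (c * (e / d)) := by
  rw [mul_assoc, bsa_mul_bsb_zpow, ← mul_assoc, ← zpow_add, Int.emod_add_mul_ediv]

theorem bsb_zpow_mul_mem_of_bsb_zpow_mul_bsa_mul_mem {c d : ℤ} (hc : 0 < c) (hd : 0 < d) {e : ℤ}
    {w : BSGroup c d} (hw : w ∈ bsPos c d) (h : bsb c d ^ e * bsa c d * w ∈ bsΛ c d) :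
    bsb c d ^ (c * (e / d)) * w ∈ bsΛ c d := by
  rcases bsΛ_cases c d h with ⟨n, -, hn⟩ | ⟨n, hn, y, hy, hny⟩
  · exact absurd hn (bsb_zpow_mul_bsa_mul_ne hc.ne' hd.ne' e n hw)
  · obtain ⟨u, hu⟩ := dvd_sub_of_bsb_zpow_mul_bsa_mul_eq hc.ne' hd.ne' hw
      (bsΛ_le_bsPos c d hy) hny
    obtain rfl : n = e + d * u := by omega
    have hw_eq : w = bsb c d ^ (c * u) * y := by
      rw [zpow_add, mul_assoc (bsb c d ^ e) _ (bsa c d), ← bsa_mul_bsb_zpow] at hny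
      simpa only [mul_assoc, mul_right_inj] using hny
    rw [hw_eq, ← mul_assoc, ← zpow_add, ← mul_add]
    refine mul_mem (bsb_zpow_mem c d (mul_nonneg hc.le ?_)) hy
    have := Int.ediv_nonneg hn hd.le
    rwa [Int.add_mul_ediv_left _ _ hd.ne'] at this

/-- A negative power of `b` to the left of digits smaller than `c` stays negative on the right. -/
theorem bsb_zpow_neg_mul_mem_of_prod {c d : ℤ} (hc : 0 < c) (hd : 0 < d) (l : List ℤ)
    (hl : ∀ j ∈ l, j < c) {g : BSGroup c d} (hg : g ∈ bsPos c d) {q : ℤ} (hq : q ≤ -1)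
    (h : bsb c d ^ (c * q) * ((l.map fun j => bsb c d ^ j * bsa c d).prod * g) ∈ bsΛ c d) :
    bsb c d ^ (-c) * g ∈ bsΛ c d := by
  induction l generalizing q with
  | nil =>
    have hpow := bsb_zpow_mem c d (n := -c - c * q) (by nlinarith)
    simpa [← mul_assoc, ← zpow_add] using mul_mem hpow h
  | cons j l ih =>
    have hj : c * q + j < 0 := by nlinarith [hl j (by simp)]
    refine ih (fun j hj => hl j (by simp [hj])) (q := (c * q + j) / d) ?_ ?_
    · have := Int.ediv_neg_of_neg_of_pos hj hd
      omega
    · refine bsb_zpow_mul_mem_of_bsb_zpow_mul_bsa_mul_mem hc hd (mul_mem ?_ hg) ?_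
      · refine list_prod_mem fun x hx => ?_
        obtain ⟨j, -, rfl⟩ := List.mem_map.1 hx
        exact mul_mem (bsb_zpow_mem_bsPos c d j) (bsΛ_le_bsPos c d (bsa_mem c d))
      · simpa only [List.map_cons, List.prod_cons, zpow_add, mul_assoc] using h

theorem alphaTup_succ (c d : ℤ) {n : ℕ} (i : Fin (n + 1) → ℤ) :
    alphaTup c d i = bsb c d ^ i 0 * bsa c d * alphaTup c d (Fin.tail i) := by
  simp [alphaTup, List.ofFn_succ, Fin.tail]

theorem alphaTup_eq_prod_map (c d : ℤ) {n : ℕ} (i : Fin n → ℤ) :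
    alphaTup c d i = ((List.ofFn i).map fun j => bsb c d ^ j * bsa c d).prod := by
  rw [alphaTup, List.map_ofFn]
  rfl

theorem alphaTup_mem {c d : ℤ} {n : ℕ} {i : Fin n → ℤ} (hi : ∀ μ, 0 ≤ i μ) :
    alphaTup c d i ∈ bsΛ c d := by
  refine list_prod_mem fun x hx => ?_
  obtain ⟨μ, rfl⟩ := List.mem_ofFn.1 hx
  exact mul_mem (bsb_zpow_mem c d (hi μ)) (bsa_mem c d)

theorem bsb_zpow_neg_mul_mem_of_alphaTup {c d : ℤ} (hc : 0 < c) (hd : 0 < d) {n : ℕ}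
    {i : Fin (n + 1) → ℤ} (hi : ∀ μ, 0 ≤ i μ ∧ i μ < c) {g : BSGroup c d} (hg : g ∈ bsPos c d)
    {e : ℤ} (he : e + i 0 < 0) (h : bsb c d ^ e * (alphaTup c d i * g) ∈ bsΛ c d) :
    bsb c d ^ (-c) * g ∈ bsΛ c d := by
  have htail : alphaTup c d (Fin.tail i) ∈ bsPos c d :=
    bsΛ_le_bsPos c d (alphaTup_mem fun μ => (hi μ.succ).1)
  have hmem := bsb_zpow_mul_mem_of_bsb_zpow_mul_bsa_mul_mem hc hd (e := e + i 0)
    (mul_mem htail hg) (by simpa only [alphaTup_succ, zpow_add, mul_assoc] using h)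
  rw [alphaTup_eq_prod_map] at hmem
  refine bsb_zpow_neg_mul_mem_of_prod hc hd _ ?_ hg ?_ hmem
  · intro j hj
    obtain ⟨μ, rfl⟩ := List.mem_ofFn.1 hj
    exact (hi μ.succ).2
  · have := Int.ediv_neg_of_neg_of_pos he hd
    omega

theorem head_eq_of_bsb_zpow_mul_alphaTup_eq {c d : ℤ} (hc : 0 < c) (hcd : c < d) {n : ℕ}
    {i j : Fin (n + 1) → ℤ} (hi : ∀ μ, 0 ≤ i μ ∧ i μ < c) (hj : ∀ μ, 0 ≤ j μ ∧ j μ < c)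
    {r q : ℤ} (h : bsb c d ^ (d * r) * alphaTup c d j = alphaTup c d i * bsb c d ^ q) :
    j 0 = i 0 := by
  have hd : 0 < d := hc.trans hcd
  have hmem : ∀ {i : Fin (n + 1) → ℤ}, (∀ μ, 0 ≤ i μ ∧ i μ < c) →
      alphaTup c d (Fin.tail i) ∈ bsPos c d := fun hi =>
    bsΛ_le_bsPos c d (alphaTup_mem fun μ => (hi μ.succ).1)
  rw [alphaTup_succ, alphaTup_succ, ← mul_assoc, ← mul_assoc, ← zpow_add, mul_assoc _ _ (_ ^ q)]
    at h
  have hdvd := dvd_sub_of_bsb_zpow_mul_bsa_mul_eq hc.ne' hd.ne' (hmem hj)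
    (mul_mem (hmem hi) (bsb_zpow_mem_bsPos c d q)) h
  have hdvd' : d ∣ i 0 - j 0 := by
    rw [← sub_sub, sub_right_comm] at hdvd
    exact (dvd_sub_left (dvd_mul_right d r)).1 hdvd
  have habs : |i 0 - j 0| < d := by
    rw [abs_lt]
    have := hi 0
    have := hj 0
    omega
  have := Int.eq_zero_of_abs_lt_dvd hdvd' habs
  omega

theorem alphaTup_mul_bsb_zpow_iterate {c d : ℤ} {n : ℕ} {S : Set (Fin n → ℤ)}
    {ψ : (Fin n → ℤ) → (Fin n → ℤ)} {r : (Fin n → ℤ) → ℤ} (hS : Set.MapsTo ψ S S)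
    (hψ : ∀ i ∈ S, bsb c d ^ (d * r i) * alphaTup c d (ψ i) = alphaTup c d i * bsb c d ^ c)
    {i : Fin n → ℤ} (hi : i ∈ S) (h : ℕ) :
    alphaTup c d i * bsb c d ^ ((h : ℤ) * c) =
      bsb c d ^ (d * ∑ μ ∈ Finset.range h, r (ψ^[μ] i)) * alphaTup c d (ψ^[h] i) := by
  induction h with
  | zero => simp
  | succ h ih =>
    rw [Nat.cast_succ, add_one_mul, zpow_add, ← mul_assoc, ih, mul_assoc,
      ← hψ _ (hS.iterate h hi), ← mul_assoc, ← zpow_add, Finset.sum_range_succ, mul_add,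
      Function.iterate_succ_apply']

/-- Case (BS2), fixed `k ≥ 1`.  Given the maps `ψ` and `r` (uniquely determined by
`b^{d·r(i)} α(ψ(i)) = α(i) b^c` with `r(i) ≥ 1`), for every `h ≥ 0` and every integer `m`
with `i₀ + d·∑_{μ<h} r(ψ^μ(i)) < m ≤ i₀ + d·∑_{μ≤h} r(ψ^μ(i))`, the element
`α(i) b^{(h+1)c} = b^{d·∑_{μ≤h} r(ψ^μ(i))} α(ψ^{h+1}(i))` is the unique minimal common
extension of `bᵐ` and `α(i)`: `bᵐΛ ∩ α(i)Λ = α(i) b^{(h+1)c} Λ`. -/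
theorem statement6 (c d : ℤ) (hc : 1 ≤ c) (hcd : c < d) (k : ℕ) (hk : 1 ≤ k)
    (ψ : (Fin (k + 1) → ℤ) → (Fin (k + 1) → ℤ)) (r : (Fin (k + 1) → ℤ) → ℤ)
    (hψ : ∀ i : Fin (k + 1) → ℤ, (∀ μ, 0 ≤ i μ ∧ i μ < c) →
      (∀ μ, 0 ≤ ψ i μ ∧ ψ i μ < c) ∧ 1 ≤ r i ∧
      bsb c d ^ (d * r i) * alphaTup c d (ψ i) = alphaTup c d i * bsb c d ^ c)
    (i : Fin (k + 1) → ℤ) (hi : ∀ μ, 0 ≤ i μ ∧ i μ < c)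
    (h : ℕ) (m : ℤ)
    (hm1 : i 0 + d * ∑ μ ∈ Finset.range h, r (ψ^[μ] i) < m)
    (hm2 : m ≤ i 0 + d * ∑ μ ∈ Finset.range (h + 1), r (ψ^[μ] i)) :
    alphaTup c d i * bsb c d ^ (((h : ℤ) + 1) * c) =
      bsb c d ^ (d * ∑ μ ∈ Finset.range (h + 1), r (ψ^[μ] i)) * alphaTup c d (ψ^[h + 1] i) ∧
    ∀ x : BSGroup c d,
      ((∃ γ ∈ bsΛ c d, x = bsb c d ^ m * γ) ∧ (∃ γ ∈ bsΛ c d, x = alphaTup c d i * γ)) ↔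
      ∃ γ ∈ bsΛ c d, x = alphaTup c d i * bsb c d ^ (((h : ℤ) + 1) * c) * γ := by
  set S : Set (Fin (k + 1) → ℤ) := {j | ∀ μ, 0 ≤ j μ ∧ j μ < c}
  have hc : 0 < c := hc
  have hd : 0 < d := hc.trans hcd
  have hS : Set.MapsTo ψ S S := fun j hj => (hψ j hj).1
  have hiter := alphaTup_mul_bsb_zpow_iterate hS (fun j hj => (hψ j hj).2.2) hi
  have hmem : ∀ n : ℕ, ψ^[n] i ∈ S := fun n => hS.iterate n hi
  have hhead : ∀ n : ℕ, (ψ^[n] i) 0 = i 0 := by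
    intro n
    induction n with
    | zero => rfl
    | succ n ih =>
      rw [Function.iterate_succ_apply', ← ih]
      obtain ⟨hψmem, -, hψeq⟩ := hψ _ (hmem n)
      exact head_eq_of_bsb_zpow_mul_alphaTup_eq hc hcd (hmem n) hψmem hψeq
  have hiter' := hiter (h + 1)
  rw [Nat.cast_succ] at hiter'
  refine ⟨hiter', fun x => ⟨?_, ?_⟩⟩
  · rintro ⟨⟨γ', hγ', hx'⟩, γ, hγ, rfl⟩
    refine ⟨bsb c d ^ (-c) * (bsb c d ^ (-((h : ℤ) * c)) * γ), ?_, ?_⟩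
    · refine bsb_zpow_neg_mul_mem_of_alphaTup hc hd (hmem h)
        (e := -m + d * ∑ μ ∈ Finset.range h, r (ψ^[μ] i))
        (mul_mem (bsb_zpow_mem_bsPos c d _) (bsΛ_le_bsPos c d hγ)) ?_ ?_
      · rw [hhead]
        omega
      · rw [zpow_add, mul_assoc, ← mul_assoc (_ ^ (d * _)), ← hiter h, mul_assoc (alphaTup c d i),
          ← mul_assoc (_ ^ ((h : ℤ) * c)), ← zpow_add, add_neg_cancel, zpow_zero, one_mul, hx',
          zpow_neg, inv_mul_cancel_left]
        exact hγ'
    · rw [mul_assoc, ← mul_assoc (_ ^ (-c)), ← zpow_add, ← mul_assoc (_ ^ (_ * c)), ← zpow_add]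
      ring_nf
      simp
  · rintro ⟨γ, hγ, rfl⟩
    refine ⟨⟨bsb c d ^ (-m) * (alphaTup c d i * bsb c d ^ (((h : ℤ) + 1) * c) * γ), ?_, ?_⟩,
      bsb c d ^ (((h : ℤ) + 1) * c) * γ, ?_, mul_assoc _ _ _⟩
    · rw [hiter', alphaTup_succ, hhead]
      simp only [← mul_assoc]
      rw [← zpow_add, ← zpow_add]
      exact mul_mem (mul_mem (mul_mem (bsb_zpow_mem c d (by omega)) (bsa_mem c d))
        (alphaTup_mem fun μ => (hmem (h + 1) μ.succ).1)) hγ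
    · rw [zpow_neg, mul_inv_cancel_left]
    · exact mul_mem (bsb_zpow_mem c d (by positivity)) hγ
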